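/- Let G be a finite graph and let O1 and O2 be two orientations of G that are equivalent, i.e., every vertex has the same out-degree under O1 as under O2. Then the set F of edges to which O1 and O2 assign opposite directions can be partitioned into edge-disjoint subsets, each of which forms a directed cycle with respect to O1 (and hence the reversed directed cycle with respect to O2). -/

import Mathlib

/-- An orientation of a finite graph with edge set `E`: each edge is assigned an initial
vertex (one of its endpoints). -/
structure EOrient {V : Type} [DecidableEq V] (E : Finset (Sym2 V)) where
  init : {e // e ∈ E} → V
  init_mem : ∀ e, init e ∈ Subtype.val e

variable {V : Type} [Fintype V] [DecidableEq V]

/-- The terminal vertex of an edge under an orientation (the other endpoint). -/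
noncomputable def EOrient.term {E : Finset (Sym2 V)} (O : EOrient E)
    (e : {e // e ∈ E}) : V :=
  Sym2.Mem.other' (O.init_mem e)

/-- The out-degree of a vertex under an orientation: the number of edges of which it is
the initial vertex. -/
def EOrient.outDeg {E : Finset (Sym2 V)} (O : EOrient E) (v : V) : ℕ :=
  (Finset.univ.filter fun e => O.init e = v).card

/-- A nonempty list of edges forms a directed cycle for the orientation `O`: cyclically,
the terminal vertex of each edge is the initial vertex of the next one. -/
noncomputable def IsDirCycle {E : Finset (Sym2 V)} (O : EOrient E)
    (c : List {e // e ∈ E}) : Prop :=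
  c ≠ [] ∧ ∀ pr ∈ c.zip (c.rotate 1), O.term pr.1 = O.init pr.2

theorem cyc_pairs {α : Type} [Fintype α] [DecidableEq α] (σ : Equiv.Perm α) (x : α)
    (i : ℕ) (hi : i < (σ.toList x).length) (hj : (i + 1) % (σ.toList x).length < (σ.toList x).length) :
    (σ.toList x)[(i + 1) % (σ.toList x).length] = σ (σ.toList x)[i] := by
  rw [Equiv.Perm.getElem_toList, Equiv.Perm.getElem_toList, Equiv.Perm.length_toList,
    Equiv.Perm.pow_mod_card_support_cycleOf_self_apply, pow_succ', Equiv.Perm.mul_apply]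

theorem zip_fwd {α : Type} (σ : α → α) (c : List α)
    (h : ∀ (i : ℕ) (hi : i < c.length) (hj : (i + 1) % c.length < c.length),
      (c)[(i + 1) % c.length] = σ (c)[i]) :
    ∀ pr ∈ c.zip (c.rotate 1), pr.2 = σ pr.1 := by
  intro pr hpr
  obtain ⟨i, hi, rfl⟩ := List.getElem_of_mem hpr
  simp only [List.length_zip, List.length_rotate, min_self] at hi
  simp only [List.getElem_zip, List.getElem_rotate]
  exact h i hi _

theorem zip_rev {α : Type} (σ : α → α) (c : List α)
    (h : ∀ (i : ℕ) (hi : i < c.length) (hj : (i + 1) % c.length < c.length),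
      (c)[(i + 1) % c.length] = σ (c)[i]) :
    ∀ pr ∈ c.reverse.zip (c.reverse.rotate 1), pr.1 = σ pr.2 := by
  intro pr hpr
  obtain ⟨i, hi, rfl⟩ := List.getElem_of_mem hpr
  simp only [List.length_zip, List.length_rotate, min_self, List.length_reverse] at hi
  simp only [List.getElem_zip, List.getElem_rotate, List.getElem_reverse, List.length_reverse]
  have hm : (i + 1) % c.length < c.length := Nat.mod_lt _ (by omega)
  rw [← h (c.length - 1 - (i + 1) % c.length) (by omega) (Nat.mod_lt _ (by omega))]
  congr 1
  by_cases hh : i + 1 < c.length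
  · rw [Nat.mod_eq_of_lt hh, Nat.mod_eq_of_lt (by omega)]; omega
  · have : i + 1 = c.length := by omega
    rw [this, Nat.mod_self]
    have : c.length - 1 - 0 + 1 = c.length := by omega
    rw [this, Nat.mod_self]; omega

theorem cyc_decomp {α : Type} [Fintype α] [DecidableEq α] (σ : Equiv.Perm α) (n : ℕ) :
    ∀ S : Finset α, S.card ≤ n → (∀ x, σ x ∈ S ↔ x ∈ S) → (∀ x ∈ S, σ x ≠ x) →
    ∃ cs : List (List α), cs.flatten.Nodup ∧ cs.flatten.toFinset = S ∧
      ∀ c ∈ cs, c ≠ [] ∧ ∀ (i : ℕ) (hi : i < c.length) (hj : (i + 1) % c.length < c.length),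
      (c)[(i + 1) % c.length] = σ (c)[i] := by
  induction n with
  | zero =>
    intro S hS _ _
    refine ⟨[], by simp, ?_, by simp⟩
    have : S = ∅ := by simpa using hS
    simp [this]
  | succ n ih =>
    intro S hS hinv hfix
    rcases S.eq_empty_or_nonempty with rfl | ⟨x, hx⟩
    · exact ⟨[], by simp, by simp, by simp⟩
    have hxs : x ∈ σ.support := by simpa using hfix x hx
    have hmem : ∀ y, y ∈ σ.toList x ↔ σ.SameCycle x y := by
      intro y; rw [Equiv.Perm.mem_toList_iff]; simp only [hxs, and_true]
    have hzp : ∀ (k : ℕ), (σ ^ k) x ∈ S := by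
      intro k
      induction k with
      | zero => simpa using hx
      | succ k ih => rw [pow_succ', Equiv.Perm.mul_apply, hinv]; exact ih
    have hsub : ∀ y ∈ σ.toList x, y ∈ S := by
      intro y hy
      obtain ⟨i, hi, rfl⟩ := List.getElem_of_mem hy
      rw [Equiv.Perm.getElem_toList]; exact hzp i
    have hxl : x ∈ σ.toList x := (hmem x).2 (Equiv.Perm.SameCycle.refl _ _)
    obtain ⟨cs, h1, h2, h3⟩ := ih (S \ (σ.toList x).toFinset) (by
        have : (S \ (σ.toList x).toFinset).card < S.card := by
          apply Finset.card_lt_card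
          refine ⟨Finset.sdiff_subset, fun h => ?_⟩
          have := h hx
          simp [hxl] at this
        omega) (by
        intro y
        simp only [Finset.mem_sdiff, List.mem_toFinset, hmem, hinv,
          Equiv.Perm.sameCycle_apply_right]) (by
        intro y hy; exact hfix y (Finset.mem_sdiff.1 hy).1)
    refine ⟨σ.toList x :: cs, ?_, ?_, ?_⟩
    · rw [List.flatten_cons, List.nodup_append']
      refine ⟨Equiv.Perm.nodup_toList _ _, h1, ?_⟩
      intro y hy hy2
      have : y ∈ cs.flatten.toFinset := List.mem_toFinset.2 hy2
      rw [h2] at this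
      simp [hy] at this
    · rw [List.flatten_cons, List.toFinset_append, h2]
      apply Finset.union_sdiff_of_subset
      intro y hy; exact hsub y (List.mem_toFinset.1 hy)
    · intro c hc
      rcases List.mem_cons.1 hc with rfl | hc
      · exact ⟨List.ne_nil_of_mem hxl, cyc_pairs σ x⟩
      · exact h3 c hc

theorem term_eq_of_ne {V : Type} [DecidableEq V] {E : Finset (Sym2 V)}
    (O1 O2 : EOrient E) (e : {e // e ∈ E}) (h : O1.init e ≠ O2.init e) :
    O1.term e = O2.init e := by
  have h1 : s(O1.init e, O1.term e) = e.1 := Sym2.other_spec' (O1.init_mem e)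
  have h2 := O2.init_mem e
  rw [← h1, Sym2.mem_iff] at h2
  rcases h2 with h2 | h2
  · exact absurd h2.symm h
  · exact h2.symm

/-- If two orientations `O1`, `O2` of a finite graph are equivalent (every
vertex has the same out-degree under both), then the set of edges on which they disagree
can be partitioned into edge-disjoint subsets, each of which forms a directed cycle with
respect to `O1` (and hence the reversed directed cycle with respect to `O2`). -/
theorem stmt1 {V : Type} [Fintype V] [DecidableEq V] (E : Finset (Sym2 V))
    (hloop : ∀ e ∈ E, ¬ e.IsDiag)
    (O1 O2 : EOrient E) (heq : ∀ v : V, O1.outDeg v = O2.outDeg v) :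
    ∃ cs : List (List {e // e ∈ E}),
      cs.flatten.Nodup ∧
      cs.flatten.toFinset = Finset.univ.filter (fun e => O1.init e ≠ O2.init e) ∧
      ∀ c ∈ cs, IsDirCycle O1 c ∧ IsDirCycle O2 c.reverse := by
  have hcard : ∀ v, Fintype.card {x : {e // O1.init e ≠ O2.init e} // O2.init x.1 = v} =
      Fintype.card {x : {e // O1.init e ≠ O2.init e} // O1.init x.1 = v} := by
    intro v
    have key : ∀ O : EOrient E,
        Fintype.card {x : {e // O1.init e ≠ O2.init e} // O.init x.1 = v} =
        ((Finset.univ.filter fun e => O.init e = v).filter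
          fun e => O1.init e ≠ O2.init e).card := by
      intro O
      rw [Fintype.card_congr (Equiv.subtypeSubtypeEquivSubtypeInter
        (fun e => O1.init e ≠ O2.init e) (fun e => O.init e = v)), Fintype.card_subtype,
        Finset.filter_filter]
      congr 1
      ext e; simp [and_comm]
    rw [key, key]
    have h := heq v
    unfold EOrient.outDeg at h
    have a1 := Finset.card_filter_add_card_filter_not
      (s := Finset.univ.filter fun e => O1.init e = v) (fun e => O1.init e ≠ O2.init e)
    have a2 := Finset.card_filter_add_card_filter_not
      (s := Finset.univ.filter fun e => O2.init e = v) (fun e => O1.init e ≠ O2.init e)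
    have a3 : ((Finset.univ.filter fun e => O1.init e = v).filter
          fun e => ¬ (O1.init e ≠ O2.init e)) = ((Finset.univ.filter fun e => O2.init e = v).filter
          fun e => ¬ (O1.init e ≠ O2.init e)) := by
      ext e
      simp only [Finset.mem_filter, Finset.mem_univ, true_and, not_not]
      constructor
      · rintro ⟨p, q⟩; exact ⟨q ▸ p, q⟩
      · rintro ⟨p, q⟩; exact ⟨q.trans p, q⟩
    rw [a3] at a1
    omega
  let τ : Equiv.Perm {e // O1.init e ≠ O2.init e} :=
    Equiv.ofFiberEquiv (f := fun x : {e // O1.init e ≠ O2.init e} => O2.init x.1) (g := fun x => O1.init x.1)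
      (fun v => Fintype.equivOfCardEq (hcard v))
  have hτ : ∀ x, O1.init (τ x).1 = O2.init x.1 := fun x =>
    Equiv.ofFiberEquiv_map (f := fun x : {e // O1.init e ≠ O2.init e} => O2.init x.1)
      (g := fun x : {e // O1.init e ≠ O2.init e} => O1.init x.1) (fun v => Fintype.equivOfCardEq (hcard v)) x
  let σ := Equiv.Perm.ofSubtype τ
  have hσ : ∀ x, (h : O1.init x ≠ O2.init x) → σ x = (τ ⟨x, h⟩).1 := fun x h =>
    Equiv.Perm.ofSubtype_apply_of_mem τ h
  have hσ1 : ∀ x, O1.init x ≠ O2.init x → O1.init (σ x) = O2.init x := fun x h => by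
    rw [hσ x h, hτ]
  obtain ⟨cs, h1, h2, h3⟩ := cyc_decomp σ _
    (Finset.univ.filter (fun e => O1.init e ≠ O2.init e)) le_rfl (by
      intro x
      simp only [Finset.mem_filter, Finset.mem_univ, true_and]
      by_cases h : O1.init x ≠ O2.init x
      · rw [hσ x h]; exact iff_of_true (τ ⟨x, h⟩).2 h
      · rw [show σ x = x from Equiv.Perm.ofSubtype_apply_of_not_mem τ h]) (by
      intro x hx he
      have hx := (Finset.mem_filter.1 hx).2
      have := hσ1 x hx
      rw [he] at this
      exact hx this)
  refine ⟨cs, h1, h2, fun c hc => ?_⟩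
  have hF : ∀ e ∈ c, O1.init e ≠ O2.init e := by
    intro e he
    have : e ∈ cs.flatten.toFinset := List.mem_toFinset.2 (List.mem_flatten.2 ⟨c, hc, he⟩)
    rw [h2] at this
    exact (Finset.mem_filter.1 this).2
  obtain ⟨hne, hi⟩ := h3 c hc
  refine ⟨⟨hne, fun pr hpr => ?_⟩, ⟨by simpa using hne, fun pr hpr => ?_⟩⟩
  · have ha := hF _ (List.of_mem_zip hpr).1
    rw [zip_fwd σ c hi pr hpr, hσ1 _ ha, term_eq_of_ne O1 O2 _ ha]
  · have ha := hF _ (List.mem_reverse.1 (List.of_mem_zip hpr).1)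
    have hb := hF _ (List.mem_reverse.1 (List.mem_rotate.1 (List.of_mem_zip hpr).2))
    rw [term_eq_of_ne O2 O1 _ ha.symm, zip_rev σ c hi pr hpr, hσ1 _ hb]
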